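/- arXiv:2105.14805 — 2 statements merged into one kernel-verified Lean document; each statement's English description precedes it below -/
import Mathlib

section
/- Let R be a circulant matrix and let Λ̃ be the diagonal matrix with Λ̃(q,q) = Σ_{m=0}^{n−1} R(0,m) e^{2πi mq/n} (so that R = W† Λ̃ W). Then for every 0 ≤ k ≤ n−1, W (R D_k) W† = Λ̃ C^k; in particular the dense matrix R D_k is similar to the single-cycle sparse matrix Λ̃ C^k, and they have the same eigenvalues. -/
open Matrix Finset

/-- The unitary DFT matrix: `W p q = n^{-1/2} e^{-2πi pq/n}`. -/
noncomputable def Wmat (n : ℕ) : Matrix (Fin n) (Fin n) ℂ :=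
  Matrix.of fun p q =>
    ((Real.sqrt n : ℂ))⁻¹ *
      Complex.exp (-(2 * (Real.pi : ℂ) * Complex.I * ((p : ℕ) : ℂ) * ((q : ℕ) : ℂ)) / n)

/-- The cyclic permutation matrix: `C p l = 1` iff `p ≡ l + 1 (mod n)`. -/
def Cmat (n : ℕ) : Matrix (Fin n) (Fin n) ℂ :=
  Matrix.of fun p l => if (p : ℕ) = ((l : ℕ) + 1) % n then 1 else 0

/-- The diagonal phase matrix: `D_k(q,q) = e^{2πi kq/n}`. -/
noncomputable def Dmat (n k : ℕ) : Matrix (Fin n) (Fin n) ℂ :=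
  Matrix.diagonal fun q : Fin n =>
    Complex.exp (2 * (Real.pi : ℂ) * Complex.I * (k : ℂ) * ((q : ℕ) : ℂ) / n)

/-- A matrix is circulant if `R p q` depends only on `(q - p) mod n`. -/
def IsCirculant {n : ℕ} [NeZero n] (R : Matrix (Fin n) (Fin n) ℂ) : Prop :=
  ∀ p q : Fin n, R p q = R 0 (q - p)

/-- `Λ̃`: the diagonal matrix with `Λ̃(q,q) = Σ_m R(0,m) e^{2πi mq/n}`. -/
noncomputable def lamTilde (n : ℕ) [NeZero n] (R : Matrix (Fin n) (Fin n) ℂ) :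
    Matrix (Fin n) (Fin n) ℂ :=
  Matrix.diagonal fun q : Fin n => ∑ m : Fin n,
    R 0 m * Complex.exp (2 * (Real.pi : ℂ) * Complex.I * ((m : ℕ) : ℂ) * ((q : ℕ) : ℂ) / n)

/-- The primitive `n`-th root of unity `e^{2πi/n}`. -/
noncomputable def dftRoot (n : ℕ) : ℂ :=
  Complex.exp (2 * (Real.pi : ℂ) * Complex.I / n)

theorem dftRoot_isPrimitiveRoot (n : ℕ) [NeZero n] : IsPrimitiveRoot (dftRoot n) n :=
  Complex.isPrimitiveRoot_exp n (NeZero.ne n)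

theorem dftRoot_ne_zero (n : ℕ) : dftRoot n ≠ 0 :=
  Complex.exp_ne_zero _

theorem dftRoot_zpow_eq_of_dvd {n : ℕ} [NeZero n] {a b : ℤ} (h : (n : ℤ) ∣ a - b) :
    dftRoot n ^ a = dftRoot n ^ b := by
  have h1 := ((dftRoot_isPrimitiveRoot n).zpow_eq_one_iff_dvd (a - b)).2 h
  rwa [zpow_sub₀ (dftRoot_ne_zero n), div_eq_one_iff_eq
    (zpow_ne_zero _ (dftRoot_ne_zero n))] at h1

/-- Orthogonality of the characters of `ℤ/n`. -/
theorem sum_dftRoot_zpow_mul (n : ℕ) [NeZero n] (a : ℤ) :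
    ∑ q : Fin n, dftRoot n ^ (a * ((q : ℕ) : ℤ)) = if (n : ℤ) ∣ a then (n : ℂ) else 0 := by
  have hpow : ∀ q : ℕ, dftRoot n ^ (a * (q : ℤ)) = (dftRoot n ^ a) ^ q := fun q => by
    rw [_root_.zpow_mul, zpow_natCast]
  simp_rw [hpow]
  rw [Fin.sum_univ_eq_sum_range (fun q => (dftRoot n ^ a) ^ q) n]
  have hiff := (dftRoot_isPrimitiveRoot n).zpow_eq_one_iff_dvd a
  split_ifs with h
  · simp [hiff.2 h]
  · have hne : dftRoot n ^ a ≠ 1 := fun h1 => h (hiff.1 h1)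
    rw [geom_sum_eq hne, ← hpow, dftRoot_zpow_eq_of_dvd (b := 0) (by simp)]
    simp

theorem Wmat_apply (n : ℕ) (p q : Fin n) :
    Wmat n p q = ((Real.sqrt n : ℂ))⁻¹ * dftRoot n ^ (-(((p : ℕ) : ℤ) * ((q : ℕ) : ℤ))) := by
  rw [Wmat, Matrix.of_apply, dftRoot, ← Complex.exp_int_mul]
  congr 2
  push_cast
  ring

theorem star_Wmat_apply (n : ℕ) (p q : Fin n) :
    star (Wmat n p q) = ((Real.sqrt n : ℂ))⁻¹ * dftRoot n ^ (((p : ℕ) : ℤ) * ((q : ℕ) : ℤ)) := by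
  rw [Wmat, Matrix.of_apply, dftRoot, ← Complex.exp_int_mul]
  simp only [RCLike.star_def, map_mul, map_inv₀, Complex.conj_ofReal, ← Complex.exp_conj]
  congr 2
  simp only [map_div₀, map_neg, map_mul, Complex.conj_ofReal, Complex.conj_I, map_natCast,
    map_ofNat]
  push_cast
  ring

theorem Dmat_eq_diagonal_zpow (n k : ℕ) :
    Dmat n k = Matrix.diagonal fun q : Fin n => dftRoot n ^ ((k : ℤ) * ((q : ℕ) : ℤ)) := by
  rw [Dmat]
  congr 1
  funext q
  rw [dftRoot, ← Complex.exp_int_mul]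
  congr 1
  push_cast
  ring

theorem Dmat_zero (n : ℕ) : Dmat n 0 = 1 := by
  simp [Dmat]

theorem Dmat_eq_pow (n k : ℕ) : Dmat n k = Dmat n 1 ^ k := by
  rw [Dmat_eq_diagonal_zpow, Dmat_eq_diagonal_zpow, Matrix.diagonal_pow]
  congr 1
  funext q
  rw [Pi.pow_apply, ← zpow_natCast, ← _root_.zpow_mul]
  congr 1
  push_cast
  ring

theorem Wmat_mul_Dmat_mul_conjTranspose_apply (n : ℕ) [NeZero n] (k : ℕ) (p l : Fin n) :
    (Wmat n * Dmat n k * (Wmat n)ᴴ) p l =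
      if (n : ℤ) ∣ ((l : ℕ) : ℤ) + k - ((p : ℕ) : ℤ) then 1 else 0 := by
  have hn : (n : ℂ) ≠ 0 := Nat.cast_ne_zero.2 (NeZero.ne n)
  have hs : ((Real.sqrt n : ℂ))⁻¹ * ((Real.sqrt n : ℂ))⁻¹ = (n : ℂ)⁻¹ := by
    rw [← mul_inv, ← Complex.ofReal_mul, Real.mul_self_sqrt (Nat.cast_nonneg n),
      Complex.ofReal_natCast]
  have hterm : ∀ q : Fin n, (Wmat n * Dmat n k) p q * (Wmat n)ᴴ q l =
      (n : ℂ)⁻¹ * dftRoot n ^ ((((l : ℕ) : ℤ) + k - ((p : ℕ) : ℤ)) * ((q : ℕ) : ℤ)) := by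
    intro q
    rw [Dmat_eq_diagonal_zpow, Matrix.mul_diagonal, Matrix.conjTranspose_apply, Wmat_apply,
      star_Wmat_apply, ← hs,
      show (((l : ℕ) : ℤ) + k - ((p : ℕ) : ℤ)) * ((q : ℕ) : ℤ) =
        -(((p : ℕ) : ℤ) * ((q : ℕ) : ℤ)) + (k : ℤ) * ((q : ℕ) : ℤ) +
          ((l : ℕ) : ℤ) * ((q : ℕ) : ℤ) by ring,
      zpow_add₀ (dftRoot_ne_zero n), zpow_add₀ (dftRoot_ne_zero n)]
    ring
  rw [Matrix.mul_apply, Finset.sum_congr rfl fun q _ => hterm q, ← Finset.mul_sum,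
    sum_dftRoot_zpow_mul]
  split_ifs <;> simp [hn]

theorem Wmat_mul_conjTranspose (n : ℕ) [NeZero n] : Wmat n * (Wmat n)ᴴ = 1 := by
  ext p l
  have h := Wmat_mul_Dmat_mul_conjTranspose_apply n 0 p l
  rw [Dmat_zero, mul_one] at h
  rw [h, Matrix.one_apply]
  refine if_congr ?_ rfl rfl
  rw [Nat.cast_zero, add_zero, ← Int.modEq_iff_dvd, Int.natCast_modEq_iff, Fin.ext_iff]
  exact ⟨fun h => h.eq_of_lt_of_lt p.2 l.2, fun h => h ▸ rfl⟩

theorem Wmat_conjTranspose_mul (n : ℕ) [NeZero n] : (Wmat n)ᴴ * Wmat n = 1 :=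
  mul_eq_one_comm.1 (Wmat_mul_conjTranspose n)

theorem Wmat_mul_Dmat_one_mul_conjTranspose (n : ℕ) [NeZero n] :
    Wmat n * Dmat n 1 * (Wmat n)ᴴ = Cmat n := by
  ext p l
  rw [Wmat_mul_Dmat_mul_conjTranspose_apply, Cmat, Matrix.of_apply]
  refine if_congr ?_ rfl rfl
  rw [← Nat.cast_add, ← Int.modEq_iff_dvd, Int.natCast_modEq_iff, Nat.ModEq,
    Nat.mod_eq_of_lt p.2]

theorem Wmat_mul_Dmat (n : ℕ) [NeZero n] (k : ℕ) :
    Wmat n * Dmat n k = Cmat n ^ k * Wmat n := by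
  have h : SemiconjBy (Wmat n) (Dmat n 1) (Cmat n) := by
    rw [SemiconjBy, ← Wmat_mul_Dmat_one_mul_conjTranspose, mul_assoc _ _ (Wmat n),
      Wmat_conjTranspose_mul, mul_one]
  rw [Dmat_eq_pow]
  exact (h.pow_right k).eq

/-- The DFT diagonalizes circulant matrices. -/
theorem Wmat_mul_of_isCirculant {n : ℕ} [NeZero n] {R : Matrix (Fin n) (Fin n) ℂ}
    (hR : IsCirculant R) : Wmat n * R = lamTilde n R * Wmat n := by
  ext p q
  rw [lamTilde, Matrix.diagonal_mul, Matrix.mul_apply, Finset.sum_mul,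
    ← (Equiv.subLeft q).sum_comp]
  refine Finset.sum_congr rfl fun m _ => ?_
  have hexp : Complex.exp (2 * (Real.pi : ℂ) * Complex.I * ((m : ℕ) : ℂ) * ((p : ℕ) : ℂ) / n) =
      dftRoot n ^ (((m : ℕ) : ℤ) * ((p : ℕ) : ℤ)) := by
    rw [dftRoot, ← Complex.exp_int_mul]
    congr 1
    push_cast
    ring
  have hdvd : (n : ℤ) ∣ (((q - m : Fin n) : ℕ) : ℤ) - (((q : ℕ) : ℤ) - ((m : ℕ) : ℤ)) := by
    rw [← Int.modEq_iff_dvd, Fin.val_sub, Int.natCast_mod, Nat.cast_add, Nat.cast_sub m.2.le]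
    refine Int.ModEq.trans ?_ (Int.mod_modEq _ _).symm
    rw [Int.modEq_iff_dvd]
    exact ⟨1, by ring⟩
  have hzpow : dftRoot n ^ (-(((p : ℕ) : ℤ) * (((q - m : Fin n) : ℕ) : ℤ))) =
      dftRoot n ^ (((m : ℕ) : ℤ) * ((p : ℕ) : ℤ)) *
        dftRoot n ^ (-(((p : ℕ) : ℤ) * ((q : ℕ) : ℤ))) := by
    rw [← zpow_add₀ (dftRoot_ne_zero n)]
    refine dftRoot_zpow_eq_of_dvd ?_
    obtain ⟨c, hc⟩ := hdvd
    exact ⟨-((p : ℕ) : ℤ) * c, by linear_combination (-((p : ℕ) : ℤ)) * hc⟩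
  rw [Equiv.subLeft_apply, hR (q - m) q, sub_sub_cancel, Wmat_apply, Wmat_apply, hexp, hzpow]
  ring

/-- Let `R` be circulant and `Λ̃` the diagonal matrix with
`Λ̃(q,q) = Σ_m R(0,m) e^{2πi mq/n}`. Then for every `0 ≤ k ≤ n-1`,
`W (R D_k) W† = Λ̃ C^k`; in particular the dense matrix `R D_k` is similar to the sparse
single-cycle matrix `Λ̃ C^k` and they have the same eigenvalues (spectrum). -/
theorem circulant_relaxation_similar (n : ℕ) [NeZero n]
    (R : Matrix (Fin n) (Fin n) ℂ) (hR : IsCirculant R) (k : Fin n) :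
    Wmat n * (R * Dmat n (k : ℕ)) * (Wmat n)ᴴ = lamTilde n R * (Cmat n) ^ (k : ℕ) ∧
    spectrum ℂ (R * Dmat n (k : ℕ)) = spectrum ℂ (lamTilde n R * (Cmat n) ^ (k : ℕ)) := by
  have hconj : Wmat n * (R * Dmat n (k : ℕ)) * (Wmat n)ᴴ =
      lamTilde n R * (Cmat n) ^ (k : ℕ) := by
    rw [← mul_assoc, Wmat_mul_of_isCirculant hR, mul_assoc (lamTilde n R), Wmat_mul_Dmat,
      mul_assoc, mul_assoc, Wmat_mul_conjTranspose, mul_one]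
  refine ⟨hconj, ?_⟩
  let u : (Matrix (Fin n) (Fin n) ℂ)ˣ :=
    ⟨Wmat n, (Wmat n)ᴴ, Wmat_mul_conjTranspose n, Wmat_conjTranspose_mul n⟩
  rw [← hconj]
  exact (spectrum.units_conjugate (u := u)).symm
end

section
/- Every n×n complex matrix A can be written as a sum of n circulant matrices with periodic relaxations on the unit circle: there exist circulant matrices R_0, …, R_{n−1} such that A = Σ_{k=0}^{n−1} R_k D_k, where D_k is the diagonal matrix with D_k(q,q) = e^{2πi kq/n}. -/
open Matrix Finset

theorem IsPrimitiveRoot.sum_div_pow {K : Type*} [Field K] {n : ℕ} [NeZero n] {ζ : K}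
    (hζ : IsPrimitiveRoot ζ n) (q s : Fin n) :
    ∑ k : Fin n, (ζ ^ (q : ℕ) / ζ ^ (s : ℕ)) ^ (k : ℕ) = if s = q then (n : K) else 0 := by
  have h0 : ζ ≠ 0 := hζ.ne_zero (NeZero.ne n)
  split_ifs with h
  · subst h
    simp [div_self (pow_ne_zero _ h0)]
  · have hne : ζ ^ (q : ℕ) / ζ ^ (s : ℕ) ≠ 1 := fun h1 =>
      h (Fin.ext (hζ.pow_inj s.2 q.2 ((div_eq_one_iff_eq (pow_ne_zero _ h0)).1 h1).symm))
    rw [Fin.sum_univ_eq_sum_range (fun k => (ζ ^ (q : ℕ) / ζ ^ (s : ℕ)) ^ k), geom_sum_eq hne,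
      div_pow, ← pow_mul, ← pow_mul, mul_comm, pow_mul, mul_comm (s : ℕ), pow_mul, hζ.pow_eq_one]
    simp

theorem Dmat_eq_diagonal_pow (n k : ℕ) :
    Dmat n k = Matrix.diagonal fun q : Fin n =>
      (Complex.exp (2 * Real.pi * Complex.I / n) ^ (q : ℕ)) ^ k := by
  unfold Dmat
  congr 1
  funext q
  rw [← Complex.exp_nat_mul, ← Complex.exp_nat_mul]
  congr 1
  ring

/-- Every `n × n` complex matrix `A` can be written as a sum of `n` circulant matrices with
periodic relaxations on the unit circle: there exist circulant matrices `R_0, …, R_{n-1}`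
such that `A = Σ_{k=0}^{n-1} R_k D_k`. -/
theorem circulant_decomposition (n : ℕ) [NeZero n] (A : Matrix (Fin n) (Fin n) ℂ) :
    ∃ R : Fin n → Matrix (Fin n) (Fin n) ℂ,
      (∀ k : Fin n, IsCirculant (R k)) ∧
      A = ∑ k : Fin n, R k * Dmat n (k : ℕ) := by
  have hζ := Complex.isPrimitiveRoot_exp n (NeZero.ne n)
  have hn : (n : ℂ) ≠ 0 := Nat.cast_ne_zero.2 (NeZero.ne n)
  simp only [Dmat_eq_diagonal_pow]
  set ζ := Complex.exp (2 * Real.pi * Complex.I / n)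
  refine ⟨fun k => Matrix.of fun p q => (n : ℂ)⁻¹ *
      ∑ s : Fin n, A (s - (q - p)) s / (ζ ^ (s : ℕ)) ^ (k : ℕ),
    fun k p q => by simp, ?_⟩
  ext p q
  simp only [Matrix.sum_apply, Matrix.mul_diagonal, Matrix.of_apply]
  symm
  calc
    _ = (n : ℂ)⁻¹ * ∑ s : Fin n, A (s - (q - p)) s *
          ∑ k : Fin n, (ζ ^ (q : ℕ) / ζ ^ (s : ℕ)) ^ (k : ℕ) := by
      simp only [Finset.mul_sum, Finset.sum_mul]
      rw [Finset.sum_comm]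
      refine Finset.sum_congr rfl fun s _ => Finset.sum_congr rfl fun k _ => ?_
      rw [div_pow]
      ring
    _ = A p q := by
      simp only [hζ.sum_div_pow]
      simp [hn, mul_comm (A p q)]
end
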